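/- arXiv:0908.0399 — 5 statements merged into one kernel-verified Lean document; each statement's English description precedes it below -/
import Mathlib

section
/- Let N ≥ 1 and M ≥ 1, and let f : ℝ × ((Fin (M+1)) → (Fin N) → ℝ) → ℝ be a smooth differential function of order M in the jet coordinates. Then f is exact (i.e., there exists a smooth F : ℝ × ((Fin M) → (Fin N) → ℝ) → ℝ such that for every smooth u : ℝ → (Fin N) → ℝ and every x ∈ ℝ, deriv (E F u) x = E f u x) if and only if for every j ∈ Fin N, every smooth u : ℝ → (Fin N) → ℝ, and every x ∈ ℝ, the Euler operator vanishes: ∑_{k=0}^{M} (−1)^k · iteratedDeriv k (fun t => (∂f/∂w k j)(t, J^M u t)) x = 0. -/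
/-- The `M`-jet of a smooth `u : ℝ → Fin N → ℝ` at `x`:
`jet1 N M u x k j` is the `k`-th derivative of the `j`-th component at `x`. -/
noncomputable def jet1 (N M : ℕ) (u : ℝ → Fin N → ℝ) (x : ℝ) :
    Fin (M + 1) → Fin N → ℝ :=
  fun k j => iteratedDeriv (k : ℕ) (fun t => u t j) x

/-- Partial derivative of a differential function `f` with respect to the jet
coordinate `w k j`. -/
noncomputable def jetPartial (N M : ℕ) (f : ℝ × ((Fin (M + 1)) → Fin N → ℝ) → ℝ)
    (k : Fin (M + 1)) (j : Fin N) : ℝ × ((Fin (M + 1)) → Fin N → ℝ) → ℝ :=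
  fun p => fderiv ℝ f p (0, fun k' j' => if k' = k ∧ j' = j then (1 : ℝ) else 0)

open scoped ContDiff

/-! ### Integrals depending on a parameter -/

theorem hasFDerivAt_intervalIntegral_of_contDiff {H E : Type*} [NormedAddCommGroup H]
    [NormedSpace ℝ H] [FiniteDimensional ℝ H] [NormedAddCommGroup E] [NormedSpace ℝ E]
    {G : H × ℝ → E} (hG : ContDiff ℝ 1 G) (a b : ℝ) (p : H) :
    HasFDerivAt (fun q => ∫ s in a..b, G (q, s))
      (∫ s in a..b, (fderiv ℝ G (p, s)).comp (ContinuousLinearMap.inl ℝ H ℝ)) p := by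
  have : ProperSpace H := FiniteDimensional.proper ℝ H
  have hcont : Continuous fun z : H × ℝ =>
      (fderiv ℝ G z).comp (ContinuousLinearMap.inl ℝ H ℝ) :=
    (hG.continuous_fderiv one_ne_zero).clm_comp continuous_const
  obtain ⟨C, hC⟩ := ((isCompact_closedBall p 1).prod (isCompact_uIcc (a := a)
    (b := b))).exists_bound_of_continuousOn hcont.continuousOn
  have hGc := hG.continuous
  refine intervalIntegral.hasFDerivAt_integral_of_dominated_of_fderiv_le (bound := fun _ => C)
    (F := fun q s => G (q, s))
    (F' := fun q s => (fderiv ℝ G (q, s)).comp (ContinuousLinearMap.inl ℝ H ℝ))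
    (Metric.closedBall_mem_nhds p one_pos) ?_ ?_ ?_ ?_ ?_ ?_
  · exact .of_forall fun q => Continuous.aestronglyMeasurable (by fun_prop)
  · exact Continuous.intervalIntegrable (by fun_prop) _ _
  · exact (hcont.comp (Continuous.prodMk_right p)).aestronglyMeasurable
  · exact .of_forall fun s hs q hq => hC (q, s) ⟨hq, Set.uIoc_subset_uIcc hs⟩
  · exact intervalIntegrable_const
  · refine .of_forall fun s _ q _ => ?_
    exact ((hG.differentiable one_ne_zero) (q, s)).hasFDerivAt.comp q (hasFDerivAt_prodMk_left q s)

theorem contDiff_intervalIntegral_of_contDiff {H : Type*} [NormedAddCommGroup H]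
    [NormedSpace ℝ H] [FiniteDimensional ℝ H] {G : H × ℝ → ℝ} (hG : ContDiff ℝ ∞ G) (a b : ℝ) :
    ContDiff ℝ ∞ fun q => ∫ s in a..b, G (q, s) := by
  rw [contDiff_infty]
  intro n
  induction n generalizing G with
  | zero =>
    rw [Nat.cast_zero, contDiff_zero]
    exact intervalIntegral.continuous_parametric_intervalIntegral_of_continuous'
      (f := fun q s => G (q, s)) hG.continuous a b
  | succ n ih =>
    have hder := hasFDerivAt_intervalIntegral_of_contDiff (hG.of_le (by simp)) a b
    rw [Nat.cast_succ, contDiff_succ_iff_fderiv_apply]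
    refine ⟨fun p => (hder p).differentiableAt, by simp, fun y => ?_⟩
    have hy : ContDiff ℝ ∞ fun z : H × ℝ => fderiv ℝ G z (y, 0) :=
      (hG.fderiv_right (m := ∞) (by simp)).clm_apply contDiff_const
    convert ih hy using 2 with p
    rw [(hder p).fderiv, ContinuousLinearMap.intervalIntegral_apply]
    · simp
    · refine Continuous.intervalIntegrable ?_ _ _
      exact ((hG.continuous_fderiv (by simp)).comp (Continuous.prodMk_right p)).clm_comp
        continuous_const

/-! ### Iterated derivatives and jets -/

theorem ContDiff.iteratedDeriv_infty {E : Type*} [NormedAddCommGroup E] [NormedSpace ℝ E]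
    {g : ℝ → E} (hg : ContDiff ℝ ∞ g) (k : ℕ) : ContDiff ℝ ∞ (iteratedDeriv k g) := by
  rw [iteratedDeriv_eq_iterate]
  exact hg.iterate_deriv k

theorem integral_mul_iteratedDeriv_eq {p h : ℝ → ℝ} (hp : ContDiff ℝ ∞ p) (hh : ContDiff ℝ ∞ h)
    {a b : ℝ} {k : ℕ} (ha : ∀ i < k, iteratedDeriv i h a = 0)
    (hb : ∀ i < k, iteratedDeriv i h b = 0) :
    ∫ t in a..b, p t * iteratedDeriv k h t =
      ∫ t in a..b, ((-1) ^ k * iteratedDeriv k p t) * h t := by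
  induction k generalizing p with
  | zero => simp
  | succ k ih =>
    have hp' := contDiff_infty_iff_deriv.1 hp
    have hk := contDiff_infty_iff_deriv.1 (hh.iteratedDeriv_infty k)
    have key := intervalIntegral.integral_mul_deriv_eq_deriv_mul (a := a) (b := b)
      (fun x _ => (hp'.1 x).hasDerivAt) (fun x _ => (hk.1 x).hasDerivAt)
      (hp'.2.continuous.intervalIntegrable _ _) (hk.2.continuous.intervalIntegrable _ _)
    rw [iteratedDeriv_succ, key, ha k k.lt_succ_self, hb k k.lt_succ_self,
      ih hp'.2 (fun i hi => ha i (hi.trans k.lt_succ_self))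
        (fun i hi => hb i (hi.trans k.lt_succ_self)), ← iteratedDeriv_succ']
    simp [pow_succ]

section Jets

variable {N : ℕ}

/-- The vector of derivatives of order less than `n` of `u` at `x`. -/
noncomputable def truncJet (n : ℕ) (u : ℝ → Fin N → ℝ) (x : ℝ) : Fin n → Fin N → ℝ :=
  fun k j => iteratedDeriv (k : ℕ) (fun t => u t j) x

theorem contDiff_truncJet (n : ℕ) {u : ℝ → Fin N → ℝ} (hu : ContDiff ℝ ∞ u) :
    ContDiff ℝ ∞ (truncJet n u) :=
  contDiff_pi' fun k => contDiff_pi' fun j => (contDiff_pi.1 hu j).iteratedDeriv_infty k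

theorem truncJet_add_smul (n : ℕ) {u h : ℝ → Fin N → ℝ} (hu : ContDiff ℝ ∞ u)
    (hh : ContDiff ℝ ∞ h) (c x : ℝ) :
    truncJet n (u + c • h) x = truncJet n u x + c • truncJet n h x := by
  ext k j
  have hu' : ContDiffAt ℝ k (fun t => u t j) x :=
    (contDiff_infty.1 (contDiff_pi.1 hu j) k).contDiffAt
  have hh' : ContDiffAt ℝ k (fun t => h t j) x :=
    (contDiff_infty.1 (contDiff_pi.1 hh j) k).contDiffAt
  have hch : ContDiffAt ℝ k (fun t => c * h t j) x := contDiffAt_const.mul hh'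
  exact (iteratedDeriv_fun_add hu' hch).trans
    (congrArg _ (iteratedDeriv_const_mul c hh'))

theorem truncJet_congr (n : ℕ) {u v : ℝ → Fin N → ℝ} {x : ℝ} (h : u =ᶠ[nhds x] v) :
    truncJet n u x = truncJet n v x := by
  ext k j
  exact Filter.EventuallyEq.iteratedDeriv_eq k (h.mono fun t ht => congrFun ht j)

theorem truncJet_zero (n : ℕ) (x : ℝ) : truncJet n (0 : ℝ → Fin N → ℝ) x = 0 := by
  ext k j
  exact iteratedDeriv_fun_const_zero

theorem truncJet_comp_sub_const (n : ℕ) (u : ℝ → Fin N → ℝ) (c x : ℝ) :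
    truncJet n (fun t => u (t - c)) x = truncJet n u (x - c) := by
  ext k j
  exact congrFun (iteratedDeriv_comp_sub_const k (fun t => u t j) c) x

end Jets

/-! ### The first variation -/

section Variation

variable {N M : ℕ} {f : ℝ × (Fin (M + 1) → Fin N → ℝ) → ℝ}

/-- The `j`-th component of the Euler operator of `f`, evaluated along `u`. -/
noncomputable def eulerOp (f : ℝ × (Fin (M + 1) → Fin N → ℝ) → ℝ) (j : Fin N)
    (u : ℝ → Fin N → ℝ) (x : ℝ) : ℝ :=
  ∑ k : Fin (M + 1), (-1 : ℝ) ^ (k : ℕ) *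
    iteratedDeriv (k : ℕ) (fun t => jetPartial N M f k j (t, jet1 N M u t)) x

theorem contDiff_jetPartial_jet (hf : ContDiff ℝ ∞ f) (k : Fin (M + 1)) (j : Fin N)
    {u : ℝ → Fin N → ℝ} (hu : ContDiff ℝ ∞ u) :
    ContDiff ℝ ∞ fun t => jetPartial N M f k j (t, jet1 N M u t) :=
  ((hf.fderiv_right (m := ∞) (by simp)).comp
    (contDiff_id.prodMk (contDiff_truncJet (M + 1) hu))).clm_apply contDiff_const

theorem continuous_eulerOp (hf : ContDiff ℝ ∞ f) (j : Fin N) {u : ℝ → Fin N → ℝ}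
    (hu : ContDiff ℝ ∞ u) : Continuous (eulerOp f j u) :=
  continuous_finsetSum _ fun k _ => continuous_const.mul
    ((contDiff_jetPartial_jet hf k j hu).iteratedDeriv_infty k).continuous

theorem fderiv_apply_eq_sum_jetPartial (p : ℝ × (Fin (M + 1) → Fin N → ℝ))
    (w : Fin (M + 1) → Fin N → ℝ) :
    fderiv ℝ f p (0, w) = ∑ j, ∑ k, jetPartial N M f k j p * w k j := by
  have hw : ((0 : ℝ), w) = ∑ j : Fin N, ∑ k : Fin (M + 1),
      w k j • ((0 : ℝ), fun k' j' => if k' = k ∧ j' = j then (1 : ℝ) else 0) := by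
    ext k' j'
    · simp [Prod.fst_sum]
    · simp [Prod.snd_sum, Finset.sum_apply, ite_and]
  rw [hw]
  simp only [map_sum, map_smul, smul_eq_mul, jetPartial, mul_comm]

/-- First variation formula: if `h` is flat to order `M - 1` at both end points, then the
derivative of the functional with density `f` in the direction `h` is the integral of the Euler
operator against `h`. -/
theorem hasDerivAt_integral_variation (hf : ContDiff ℝ ∞ f) {u h : ℝ → Fin N → ℝ}
    (hu : ContDiff ℝ ∞ u) (hh : ContDiff ℝ ∞ h) {a b : ℝ} (ha : truncJet M h a = 0)
    (hb : truncJet M h b = 0) (c : ℝ) :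
    HasDerivAt (fun c : ℝ => ∫ t in a..b, f (t, jet1 N M (u + c • h) t))
      (∫ t in a..b, ∑ j, eulerOp f j (u + c • h) t * h t j) c := by
  have hju := contDiff_truncJet (M + 1) hu
  have hjh := contDiff_truncJet (M + 1) hh
  have hv : ContDiff ℝ ∞ (u + c • h) := hu.add (contDiff_const.smul hh)
  have hγ : ContDiff ℝ ∞ fun z : ℝ × ℝ =>
      (z.2, truncJet (M + 1) u z.2 + z.1 • truncJet (M + 1) h z.2) := by fun_prop
  have hG := hf.comp hγ
  have hjet (c t : ℝ) : jet1 N M (u + c • h) t = truncJet (M + 1) u t + c • truncJet (M + 1) h t :=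
    truncJet_add_smul (M + 1) hu hh c t
  have hflat (x : ℝ) (hx : truncJet M h x = 0) (j : Fin N) (k : Fin (M + 1)) (i : ℕ)
      (hi : i < k) : iteratedDeriv i (fun t => h t j) x = 0 :=
    congrFun (congrFun hx ⟨i, hi.trans_le (Nat.lt_succ_iff.1 k.2)⟩) j
  have hder := (hasFDerivAt_intervalIntegral_of_contDiff (hG.of_le (by simp)) a b c).hasDerivAt
  simp only [hjet]
  refine hder.congr_deriv (Eq.symm ?_)
  rw [ContinuousLinearMap.intervalIntegral_apply]
  swap
  · refine Continuous.intervalIntegrable ?_ _ _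
    exact ((hG.continuous_fderiv (by simp)).comp (Continuous.prodMk_right c)).clm_comp
      continuous_const
  have hint (j : Fin N) (k : Fin (M + 1)) : Continuous fun t =>
      jetPartial N M f k j (t, jet1 N M (u + c • h) t) * iteratedDeriv k (fun s => h s j) t :=
    (contDiff_jetPartial_jet hf k j hv).continuous.mul
      ((contDiff_pi.1 hh j).iteratedDeriv_infty k).continuous
  have hint' (j : Fin N) (k : Fin (M + 1)) : Continuous fun t => ((-1 : ℝ) ^ (k : ℕ) *
      iteratedDeriv k (fun s => jetPartial N M f k j (s, jet1 N M (u + c • h) s)) t) * h t j :=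
    (continuous_const.mul
      ((contDiff_jetPartial_jet hf k j hv).iteratedDeriv_infty k).continuous).mul
      (contDiff_pi.1 hh j).continuous
  calc ∫ t in a..b, ∑ j, eulerOp f j (u + c • h) t * h t j
      = ∑ j, ∑ k : Fin (M + 1), ∫ t in a..b, ((-1 : ℝ) ^ (k : ℕ) * iteratedDeriv k
          (fun s => jetPartial N M f k j (s, jet1 N M (u + c • h) s)) t) * h t j := by
        simp only [eulerOp, Finset.sum_mul]
        rw [intervalIntegral.integral_finsetSum fun j _ =>
          (continuous_finsetSum _ fun k _ => hint' j k).intervalIntegrable _ _]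
        refine Finset.sum_congr rfl fun j _ => ?_
        exact intervalIntegral.integral_finsetSum fun k _ => (hint' j k).intervalIntegrable _ _
    _ = ∑ j, ∑ k : Fin (M + 1), ∫ t in a..b, jetPartial N M f k j (t, jet1 N M (u + c • h) t) *
          iteratedDeriv k (fun s => h s j) t := by
        refine Finset.sum_congr rfl fun j _ => Finset.sum_congr rfl fun k _ => ?_
        exact (integral_mul_iteratedDeriv_eq (contDiff_jetPartial_jet hf k j hv)
          (contDiff_pi.1 hh j) (hflat a ha j k) (hflat b hb j k)).symm
    _ = ∫ t in a..b, ∑ j, ∑ k : Fin (M + 1), jetPartial N M f k j (t, jet1 N M (u + c • h) t) *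
          iteratedDeriv k (fun s => h s j) t := by
        rw [intervalIntegral.integral_finsetSum fun j _ =>
          (continuous_finsetSum _ fun k _ => hint j k).intervalIntegrable _ _]
        refine Finset.sum_congr rfl fun j _ => ?_
        exact (intervalIntegral.integral_finsetSum fun k _ =>
          (hint j k).intervalIntegrable _ _).symm
    _ = _ := by
        refine intervalIntegral.integral_congr fun t _ => ?_
        have hline : HasDerivAt (fun c : ℝ => (t, truncJet (M + 1) u t + c • truncJet (M + 1) h t))
            (0, truncJet (M + 1) h t) c := by
          simpa using (hasDerivAt_const c t).prodMk
            (((hasDerivAt_id c).smul_const (truncJet (M + 1) h t)).const_add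
              (truncJet (M + 1) u t))
        have h1 := (hf.differentiable (by simp) _).hasFDerivAt.comp_hasDerivAt c hline
        have h2 := ((hG.differentiable (by simp) (c, t)).hasFDerivAt.comp c
          (hasFDerivAt_prodMk_left c t)).hasDerivAt
        refine Eq.trans ?_ (h1.unique h2)
        rw [fderiv_apply_eq_sum_jetPartial]
        simp only [hjet]
        rfl

/-- A Lagrangian with vanishing Euler operator is null: its integral depends only on the jets of
order `M - 1` at the end points. -/
theorem integral_eq_of_eulerOp_eq_zero (hf : ContDiff ℝ ∞ f)
    (hE : ∀ j (u : ℝ → Fin N → ℝ), ContDiff ℝ ∞ u → ∀ x, eulerOp f j u x = 0)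
    {u v : ℝ → Fin N → ℝ} (hu : ContDiff ℝ ∞ u) (hv : ContDiff ℝ ∞ v) {a b : ℝ}
    (ha : truncJet M u a = truncJet M v a) (hb : truncJet M u b = truncJet M v b) :
    ∫ t in a..b, f (t, jet1 N M u t) = ∫ t in a..b, f (t, jet1 N M v t) := by
  have hflat (x : ℝ) (hx : truncJet M u x = truncJet M v x) :
      truncJet M (v + (-1 : ℝ) • u) x = 0 := by
    rw [truncJet_add_smul M hv hu, hx]
    simp
  have hh : ContDiff ℝ ∞ (v + (-1 : ℝ) • u) := hv.add (contDiff_const.smul hu)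
  have hder := hasDerivAt_integral_variation hf hu hh (hflat a ha) (hflat b hb)
  have hconst := is_const_of_deriv_eq_zero (fun c => (hder c).differentiableAt) (fun c => by
    rw [(hder c).deriv]
    have huc : ContDiff ℝ ∞ (u + c • (v + (-1 : ℝ) • u)) := hu.add (contDiff_const.smul hh)
    simp only [hE _ _ huc, zero_mul, Finset.sum_const_zero,
      intervalIntegral.integral_zero]) 0 1
  simpa using hconst

/-- The Euler operator annihilates total derivatives. -/
theorem eulerOp_eq_zero_of_exact (hf : ContDiff ℝ ∞ f) {F : ℝ × (Fin M → Fin N → ℝ) → ℝ}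
    (hF : ContDiff ℝ ∞ F) (hFf : ∀ u : ℝ → Fin N → ℝ, ContDiff ℝ ∞ u → ∀ x : ℝ,
      deriv (fun t => F (t, truncJet M u t)) x = f (x, jet1 N M u x))
    (j : Fin N) {u : ℝ → Fin N → ℝ} (hu : ContDiff ℝ ∞ u) (x : ℝ) : eulerOp f j u x = 0 := by
  have hcont := continuous_eulerOp hf j hu
  have hae : eulerOp f j u =ᵐ[MeasureTheory.volume] fun _ => 0 := by
    refine ae_eq_zero_of_integral_contDiff_smul_eq_zero hcont.locallyIntegrable fun g hg hgs => ?_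
    obtain ⟨R, hR⟩ := hgs.isBounded.subset_ball 0
    have hzero (x : ℝ) (hx : x ∉ Metric.ball (0 : ℝ) R) : g =ᶠ[nhds x] 0 :=
      notMem_tsupport_iff_eventuallyEq.1 fun h => hx (hR h)
    have hh : ContDiff ℝ ∞ fun t => Pi.single (M := fun _ : Fin N => ℝ) j (g t) :=
      (ContinuousLinearMap.single ℝ (fun _ : Fin N => ℝ) j).contDiff.comp hg
    have hflat (x : ℝ) (hx : x ∉ Metric.ball (0 : ℝ) R) :
        truncJet M (fun t => Pi.single (M := fun _ : Fin N => ℝ) j (g t)) x = 0 := by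
      rw [← truncJet_zero M x]
      refine truncJet_congr M ((hzero x hx).mono fun t ht => ?_)
      simp [ht]
    have ha : -|R| ∉ Metric.ball (0 : ℝ) R := by simp [le_abs_self]
    have hb : |R| ∉ Metric.ball (0 : ℝ) R := by simp [le_abs_self]
    have hder := hasDerivAt_integral_variation hf hu hh (hflat _ ha) (hflat _ hb) 0
    have hconst : (fun c : ℝ => ∫ t in -|R|..|R|, f (t, jet1 N M
        (u + c • fun t => Pi.single (M := fun _ : Fin N => ℝ) j (g t)) t)) =
        fun _ => F (|R|, truncJet M u |R|) - F (-|R|, truncJet M u (-|R|)) := by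
      ext c
      have hv : ContDiff ℝ ∞ (u + c • fun t => Pi.single (M := fun _ : Fin N => ℝ) j (g t)) :=
        hu.add (contDiff_const.smul hh)
      have hFv := hF.comp (contDiff_id.prodMk (contDiff_truncJet M hv))
      have hftc := intervalIntegral.integral_eq_sub_of_hasDerivAt (a := -|R|) (b := |R|)
        (fun x _ => ((contDiff_infty_iff_deriv.1 hFv).1 x).hasDerivAt)
        ((contDiff_infty_iff_deriv.1 hFv).2.continuous.intervalIntegrable _ _)
      have hjet (x : ℝ) (hx : x ∉ Metric.ball (0 : ℝ) R) : truncJet M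
          (u + c • fun t => Pi.single (M := fun _ : Fin N => ℝ) j (g t)) x = truncJet M u x := by
        rw [truncJet_add_smul M hu hh, hflat x hx, smul_zero, add_zero]
      simp only [Function.comp_def, id, hFf _ hv, hjet _ ha, hjet _ hb] at hftc
      exact hftc
    rw [hconst] at hder
    have h0 := hder.unique (hasDerivAt_const _ _)
    rw [intervalIntegral.integral_congr (g := fun t => g t • eulerOp f j u t) fun t _ => by
      simp [Pi.single_apply, mul_comm]] at h0
    rwa [intervalIntegral.integral_eq_integral_of_support_subset] at h0
    intro t ht
    have ht' : t ∈ tsupport g := subset_tsupport _ (Function.support_smul_subset_left _ _ ht)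
    have := hR ht'
    rw [mem_ball_zero_iff, Real.norm_eq_abs] at this
    have := abs_lt.1 (this.trans_le (le_abs_self R))
    exact ⟨this.1, this.2.le⟩
  exact congrFun (hcont.ae_eq_iff_eq MeasureTheory.volume continuous_const |>.1 hae) x

end Variation

/-! ### Construction of a primitive -/

/-- A smooth cutoff, equal to `1` on `[-1/3, ∞)` and to `0` on `(-∞, -2/3]`. -/
noncomputable def leftCutoff (t : ℝ) : ℝ := Real.smoothTransition (3 * t + 2)

theorem contDiff_leftCutoff : ContDiff ℝ ∞ leftCutoff :=
  Real.smoothTransition.contDiff.comp (by fun_prop)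

theorem leftCutoff_eventuallyEq_one {t : ℝ} (ht : -1 / 3 < t) : leftCutoff =ᶠ[nhds t] 1 := by
  filter_upwards [lt_mem_nhds ht] with s hs
  exact Real.smoothTransition.one_of_one_le (by linarith)

theorem leftCutoff_eventuallyEq_zero {t : ℝ} (ht : t < -2 / 3) : leftCutoff =ᶠ[nhds t] 0 := by
  filter_upwards [gt_mem_nhds ht] with s hs
  exact Real.smoothTransition.zero_of_nonpos (by linarith)

section Primitive

variable {N M : ℕ}

/-- A smooth curve with jet `w` at `0` which vanishes on `(-∞, -2/3]`. -/
noncomputable def jetExtension (w : Fin M → Fin N → ℝ) (t : ℝ) : Fin N → ℝ :=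
  fun j => ∑ k : Fin M, w k j * (leftCutoff t * (t ^ (k : ℕ) / (k : ℕ).factorial))

theorem contDiff_leftCutoff_mul_pow (k : ℕ) :
    ContDiff ℝ ∞ fun t : ℝ => leftCutoff t * (t ^ k / k.factorial) :=
  contDiff_leftCutoff.mul (by fun_prop)

theorem contDiff_jetExtension (w : Fin M → Fin N → ℝ) : ContDiff ℝ ∞ (jetExtension w) :=
  contDiff_pi' fun _ => ContDiff.sum fun k _ =>
    contDiff_const.mul (contDiff_leftCutoff_mul_pow k)

theorem iteratedDeriv_jetExtension (w : Fin M → Fin N → ℝ) (j : Fin N) (n : ℕ) (t : ℝ) :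
    iteratedDeriv n (fun s => jetExtension w s j) t = ∑ k : Fin M, w k j *
      iteratedDeriv n (fun s : ℝ => leftCutoff s * (s ^ (k : ℕ) / (k : ℕ).factorial)) t := by
  have hc (k : Fin M) := (contDiff_infty.1 (contDiff_leftCutoff_mul_pow k) n).contDiffAt (x := t)
  simp only [jetExtension]
  rw [iteratedDeriv_fun_sum fun k _ => contDiffAt_const.mul (hc k)]
  exact Finset.sum_congr rfl fun k _ => iteratedDeriv_const_mul _ (hc k)

theorem truncJet_jetExtension_zero (w : Fin M → Fin N → ℝ) :
    truncJet M (jetExtension w) 0 = w := by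
  ext i j
  have hmono (k : Fin M) : iteratedDeriv i
      (fun s : ℝ => leftCutoff s * (s ^ (k : ℕ) / (k : ℕ).factorial)) 0 =
      if i = k then 1 else 0 := by
    have heq : (fun s : ℝ => leftCutoff s * (s ^ (k : ℕ) / (k : ℕ).factorial)) =ᶠ[nhds 0]
        fun s => s ^ (k : ℕ) / (k : ℕ).factorial := by
      filter_upwards [leftCutoff_eventuallyEq_one (t := 0) (by norm_num)] with s hs
      simp [hs]
    rw [heq.iteratedDeriv_eq, iteratedDeriv_div_const, iteratedDeriv_fun_pow_zero]
    have := (k : ℕ).factorial_ne_zero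
    simp only [← Fin.ext_iff]
    split_ifs
    · field_simp
    · simp
  simp [truncJet, iteratedDeriv_jetExtension, hmono]

theorem contDiff_truncJet_jetExtension (n : ℕ) :
    ContDiff ℝ ∞ fun z : (Fin M → Fin N → ℝ) × ℝ => truncJet n (jetExtension z.1) z.2 := by
  refine contDiff_pi' fun i => contDiff_pi' fun j => ?_
  simp only [truncJet, iteratedDeriv_jetExtension]
  refine ContDiff.sum fun k _ => ContDiff.mul (by fun_prop) ?_
  exact ((contDiff_leftCutoff_mul_pow k).iteratedDeriv_infty i).comp contDiff_snd

theorem jetExtension_eventuallyEq_zero (w : Fin M → Fin N → ℝ) {t : ℝ} (ht : t < -2 / 3) :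
    jetExtension w =ᶠ[nhds t] 0 := by
  filter_upwards [leftCutoff_eventuallyEq_zero ht] with s hs
  ext j
  simp [jetExtension, hs]

/-- A primitive of a differential function with vanishing Euler operator: integrate `f` along a
curve that vanishes far to the left and has the prescribed jet at the right end point. -/
noncomputable def eulerPrimitive (f : ℝ × (Fin (M + 1) → Fin N → ℝ) → ℝ)
    (p : ℝ × (Fin M → Fin N → ℝ)) : ℝ :=
  (∫ s in (-1 : ℝ)..0, f (p.1 + s, jet1 N M (jetExtension p.2) s)) + ∫ t in 0..(p.1 - 1), f (t, 0)

variable {f : ℝ × (Fin (M + 1) → Fin N → ℝ) → ℝ}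

theorem contDiff_eulerPrimitive (hf : ContDiff ℝ ∞ f) : ContDiff ℝ ∞ (eulerPrimitive f) := by
  refine ContDiff.add ?_ ?_
  · refine contDiff_intervalIntegral_of_contDiff
      (G := fun z : (ℝ × (Fin M → Fin N → ℝ)) × ℝ =>
        f (z.1.1 + z.2, jet1 N M (jetExtension z.1.2) z.2)) ?_ _ _
    refine hf.comp (ContDiff.prodMk (by fun_prop) ?_)
    exact (contDiff_truncJet_jetExtension (M + 1)).comp
      (contDiff_fst.snd.prodMk contDiff_snd)
  · have hg : ContDiff ℝ ∞ fun t : ℝ => f (t, 0) := hf.comp (by fun_prop)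
    have hprim : ContDiff ℝ ∞ fun y : ℝ => ∫ t in 0..y, f (t, 0) := by
      refine contDiff_infty_iff_deriv.2 ⟨intervalIntegral.differentiable_integral_of_continuous
        hg.continuous, ?_⟩
      rwa [funext fun y => hg.continuous.deriv_integral _ 0 y]
    exact hprim.comp (contDiff_fst.sub contDiff_const)

theorem eulerPrimitive_eq_integral (hf : ContDiff ℝ ∞ f) {a x : ℝ} (ha : a ≤ x - 1)
    (w : Fin M → Fin N → ℝ) :
    eulerPrimitive f (x, w) = (∫ t in a..x, f (t, jet1 N M (fun t => jetExtension w (t - x)) t)) +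
      ∫ t in 0..a, f (t, 0) := by
  have hv : ContDiff ℝ ∞ fun t => jetExtension w (t - x) :=
    (contDiff_jetExtension w).comp (by fun_prop)
  have hcont : Continuous fun t => f (t, jet1 N M (fun t => jetExtension w (t - x)) t) :=
    (hf.comp (contDiff_id.prodMk (contDiff_truncJet (M + 1) hv))).continuous
  have hcont0 : Continuous fun t : ℝ => f (t, 0) := hf.continuous.comp (by fun_prop)
  have hjet (t : ℝ) : jet1 N M (fun t => jetExtension w (t - x)) t =
      jet1 N M (jetExtension w) (t - x) := truncJet_comp_sub_const (M + 1) (jetExtension w) x t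
  have hleft : ∫ t in a..(x - 1), f (t, jet1 N M (fun t => jetExtension w (t - x)) t) =
      ∫ t in a..(x - 1), f (t, 0) := by
    refine intervalIntegral.integral_congr fun t ht => ?_
    rw [Set.uIcc_of_le ha] at ht
    have hz : jet1 N M (jetExtension w) (t - x) = 0 :=
      (truncJet_congr (M + 1) (jetExtension_eventuallyEq_zero w (by linarith [ht.2]))).trans
        (truncJet_zero (M + 1) _)
    simp only [hjet, hz]
  have hright : ∫ t in (x - 1)..x, f (t, jet1 N M (fun t => jetExtension w (t - x)) t) =
      ∫ s in (-1 : ℝ)..0, f (x + s, jet1 N M (jetExtension w) s) := by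
    have := intervalIntegral.integral_comp_sub_right (a := x - 1) (b := x)
      (fun s => f (x + s, jet1 N M (jetExtension w) s)) x
    simp only [add_sub_cancel, sub_self, sub_sub_cancel_left] at this
    simpa only [hjet] using this
  rw [← intervalIntegral.integral_add_adjacent_intervals (hcont.intervalIntegrable a (x - 1))
    (hcont.intervalIntegrable (x - 1) x), hleft, hright, eulerPrimitive,
    ← intervalIntegral.integral_add_adjacent_intervals (hcont0.intervalIntegrable 0 a)
    (hcont0.intervalIntegrable a (x - 1))]
  ring

theorem deriv_eulerPrimitive_jet (hf : ContDiff ℝ ∞ f)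
    (hE : ∀ j (u : ℝ → Fin N → ℝ), ContDiff ℝ ∞ u → ∀ x, eulerOp f j u x = 0)
    {u : ℝ → Fin N → ℝ} (hu : ContDiff ℝ ∞ u) (x : ℝ) :
    deriv (fun t => eulerPrimitive f (t, truncJet M u t)) x = f (x, jet1 N M u x) := by
  set v : ℝ → Fin N → ℝ := fun t => leftCutoff (t - x) • u t with hv_def
  have hv : ContDiff ℝ ∞ v := (contDiff_leftCutoff.comp (by fun_prop)).smul hu
  have hvu {y : ℝ} (hy : -1 / 3 < y - x) : v =ᶠ[nhds y] u := by
    have := (continuous_sub_right x).continuousAt.eventually (leftCutoff_eventuallyEq_one hy)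
    filter_upwards [this] with t ht
    simp [hv_def, ht]
  have hv0 : v =ᶠ[nhds (x - 2)] 0 := by
    have := (continuous_sub_right x).continuousAt.eventually
      (leftCutoff_eventuallyEq_zero (t := x - 2 - x) (by linarith))
    filter_upwards [this] with t ht
    simp [hv_def, ht]
  have hcont : Continuous fun t => f (t, jet1 N M v t) :=
    (hf.comp (contDiff_id.prodMk (contDiff_truncJet (M + 1) hv))).continuous
  have heq : (fun t => eulerPrimitive f (t, truncJet M u t)) =ᶠ[nhds x] fun y =>
      (∫ t in (x - 2)..y, f (t, jet1 N M v t)) + ∫ t in 0..(x - 2), f (t, 0) := by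
    filter_upwards [lt_mem_nhds (show x - 1 / 3 < x by linarith)] with y hy
    have hw : ContDiff ℝ ∞ fun t => jetExtension (truncJet M u y) (t - y) :=
      (contDiff_jetExtension _).comp (by fun_prop)
    rw [eulerPrimitive_eq_integral hf (a := x - 2) (by linarith)]
    congr 1
    refine integral_eq_of_eulerOp_eq_zero hf hE hw hv ?_ ?_
    · rw [truncJet_comp_sub_const, truncJet_congr M hv0,
        truncJet_congr M (jetExtension_eventuallyEq_zero _ (by linarith)), truncJet_zero,
        truncJet_zero]
    · rw [truncJet_comp_sub_const, sub_self, truncJet_jetExtension_zero,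
        truncJet_congr M (hvu (by linarith))]
  rw [heq.deriv_eq, deriv_add_const, hcont.deriv_integral]
  exact congrArg (fun w => f (x, w)) (truncJet_congr (M + 1) (hvu (by simp; norm_num)))

end Primitive

/-- A differential function of order `M` in one independent variable is exact
(is a total `x`-derivative of a differential function of order `M - 1`) if and
only if its Euler operator (variational derivative) vanishes identically along
every smooth function `u`. -/
theorem exact_iff_euler_vanishes_1D (N M : ℕ) (hN : 1 ≤ N) (hM : 1 ≤ M)
    (f : ℝ × ((Fin (M + 1)) → Fin N → ℝ) → ℝ) (hf : ContDiff ℝ (⊤ : ℕ∞) f) :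
    (∃ F : ℝ × ((Fin M) → Fin N → ℝ) → ℝ, ContDiff ℝ (⊤ : ℕ∞) F ∧
      ∀ u : ℝ → Fin N → ℝ, ContDiff ℝ (⊤ : ℕ∞) u → ∀ x : ℝ,
        deriv (fun t => F (t, fun k j => iteratedDeriv (k : ℕ) (fun s => u s j) t)) x
          = f (x, jet1 N M u x)) ↔
    (∀ j : Fin N, ∀ u : ℝ → Fin N → ℝ, ContDiff ℝ (⊤ : ℕ∞) u → ∀ x : ℝ,
      ∑ k : Fin (M + 1), (-1 : ℝ) ^ (k : ℕ) *
        iteratedDeriv (k : ℕ) (fun t => jetPartial N M f k j (t, jet1 N M u t)) x = 0) := by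
  constructor
  · rintro ⟨F, hF, hFf⟩ j u hu x
    exact eulerOp_eq_zero_of_exact hf hF hFf j hu x
  · intro hE
    exact ⟨eulerPrimitive f, contDiff_eulerPrimitive hf, fun u hu x =>
      deriv_eulerPrimitive_jet hf hE hu x⟩
end

section
/- Let n ≥ 1, let g : ℝⁿ → ℝ be continuously differentiable, and let λ₀ ∈ (0, 1]. Define h : ℝⁿ → ℝ by h(x) = ∫_{λ₀}^{1} g(λx) / λ dλ. Then h is differentiable and for every x ∈ ℝⁿ, the degree operator applied to h recovers g up to the shifted term: ∑_{i=1}^{n} xᵢ · (∂h/∂xᵢ)(x) = g(x) − g(λ₀ x). -/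
open MeasureTheory in
/-- Differentiation under the integral sign for the homotopy integral: the factor `t` coming
from the inner derivative cancels the weight `1 / t`. -/
theorem hasFDerivAt_integral_comp_smul_div {E : Type*} [NormedAddCommGroup E] [NormedSpace ℝ E]
    [ProperSpace E] {g : E → ℝ} (hg : ContDiff ℝ 1 g) {a b : ℝ} (ha : 0 < a) (hb : 0 < b) (x : E) :
    HasFDerivAt (fun y : E => ∫ t in a..b, g (t • y) / t)
      (∫ t in a..b, fderiv ℝ g (t • x)) x := by
  have hpos : ∀ t ∈ Set.uIcc a b, 0 < t := fun t ht => (lt_min ha hb).trans_le ht.1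
  have hint : ∀ y : E, IntervalIntegrable (fun t : ℝ => g (t • y) / t) volume a b := fun y =>
    ContinuousOn.intervalIntegrable <| ContinuousOn.div
      (hg.continuous.comp (continuous_id.smul continuous_const)).continuousOn continuousOn_id
      fun t ht => (hpos t ht).ne'
  have hcont : Continuous fun p : ℝ × E => fderiv ℝ g (p.1 • p.2) :=
    (hg.continuous_fderiv one_ne_zero).comp (continuous_fst.smul continuous_snd)
  obtain ⟨C, hC⟩ := ((isCompact_uIcc (a := a) (b := b)).prod
    (isCompact_closedBall x 1)).exists_bound_of_continuousOn hcont.continuousOn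
  refine intervalIntegral.hasFDerivAt_integral_of_dominated_of_fderiv_le
    (F' := fun y t => fderiv ℝ g (t • y)) (bound := fun _ => C)
    (Metric.closedBall_mem_nhds x one_pos)
    (Filter.Eventually.of_forall fun y => (hint y).def'.aestronglyMeasurable) (hint x)
    (hcont.comp (continuous_id.prodMk continuous_const)).aestronglyMeasurable
    (Filter.Eventually.of_forall fun t ht y hy => hC (t, y) ⟨Set.uIoc_subset_uIcc ht, hy⟩)
    intervalIntegrable_const (Filter.Eventually.of_forall fun t ht y _ => ?_)
  have ht0 : t ≠ 0 := (hpos t (Set.uIoc_subset_uIcc ht)).ne'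
  have h := ((hg.differentiable one_ne_zero (t • y)).hasFDerivAt.comp y
    ((hasFDerivAt_id (𝕜 := ℝ) y).const_smul t)).mul_const t⁻¹
  simp only [← div_eq_mul_inv] at h
  refine h.congr_fderiv ?_
  ext v
  simp [ht0]

/-- The fundamental theorem of calculus along the segment from `a • x` to `b • x`. -/
theorem integral_fderiv_smul_apply {E : Type*} [NormedAddCommGroup E] [NormedSpace ℝ E]
    {g : E → ℝ} (hg : ContDiff ℝ 1 g) (a b : ℝ) (x : E) :
    (∫ t in a..b, fderiv ℝ g (t • x)) x = g (b • x) - g (a • x) := by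
  have hcont : Continuous fun t : ℝ => fderiv ℝ g (t • x) :=
    (hg.continuous_fderiv one_ne_zero).comp (continuous_id.smul continuous_const)
  rw [ContinuousLinearMap.intervalIntegral_apply (hcont.intervalIntegrable a b)]
  refine intervalIntegral.integral_eq_sub_of_hasDerivAt (f := fun t : ℝ => g (t • x))
    (fun t _ => ?_) ((hcont.clm_apply continuous_const).intervalIntegrable a b)
  have h := (hg.differentiable one_ne_zero (t • x)).hasFDerivAt.comp_hasDerivAt t
    ((hasDerivAt_id t).smul_const x)
  simpa [Function.comp_def] using h

/-- The homotopy integral `h(x) = ∫_{λ₀}^1 g(λx)/λ dλ` inverts the degree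
operator up to the shifted term: `(M h)(x) = g(x) - g(λ₀ x)`. -/
theorem degreeOperator_homotopy_integral (n : ℕ) (hn : 1 ≤ n)
    (g : EuclideanSpace ℝ (Fin n) → ℝ) (hg : ContDiff ℝ 1 g)
    (lam₀ : ℝ) (hlam₀ : lam₀ ∈ Set.Ioc (0 : ℝ) 1) :
    Differentiable ℝ (fun x : EuclideanSpace ℝ (Fin n) =>
        ∫ lam in lam₀..1, g (lam • x) / lam) ∧
    ∀ x : EuclideanSpace ℝ (Fin n),
      ∑ i : Fin n, x i *
        fderiv ℝ (fun y : EuclideanSpace ℝ (Fin n) => ∫ lam in lam₀..1, g (lam • y) / lam) x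
          (EuclideanSpace.single i 1)
        = g x - g (lam₀ • x) := by
  have hderiv := hasFDerivAt_integral_comp_smul_div hg hlam₀.1 one_pos
  refine ⟨fun x => (hderiv x).differentiableAt, fun x => ?_⟩
  have hx : ∑ i : Fin n, x i • EuclideanSpace.single i (1 : ℝ) = x := by
    simpa using (EuclideanSpace.basisFun (Fin n) ℝ).sum_repr x
  rw [(hderiv x).fderiv]
  simp only [← smul_eq_mul, ← map_smul, ← map_sum]
  rw [hx, integral_fderiv_smul_apply hg, one_smul]
end

section
/- Let N ≥ 1, m ≥ 0, and let g : ℝ × ((Fin (m+1)) → (Fin N) → ℝ) → ℝ be smooth. Then the degree operator and the formal total derivative commute: M (D_x g) = D_x (M g) as smooth functions on ℝ × ((Fin (m+2)) → (Fin N) → ℝ). -/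
/-- Partial derivative of `g` with respect to the jet coordinate `w k j`. -/
noncomputable def jetD (N m : ℕ) (g : ℝ × ((Fin (m + 1)) → Fin N → ℝ) → ℝ)
    (k : Fin (m + 1)) (j : Fin N) : ℝ × ((Fin (m + 1)) → Fin N → ℝ) → ℝ :=
  fun p => fderiv ℝ g p (0, fun k' j' => if k' = k ∧ j' = j then (1 : ℝ) else 0)

/-- Partial derivative of `g` with respect to the independent variable `x`. -/
noncomputable def xD (N m : ℕ) (g : ℝ × ((Fin (m + 1)) → Fin N → ℝ) → ℝ) :
    ℝ × ((Fin (m + 1)) → Fin N → ℝ) → ℝ :=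
  fun p => fderiv ℝ g p (1, 0)

/-- The formal total derivative `D_x` of a differential function of order `m`,
a differential function of order `m + 1`:
`(D_x g)(x, w) = ∂g/∂x + ∑_j ∑_{k=0}^m w (k+1) j ⬝ ∂g/∂(w k j)`. -/
noncomputable def totalDx (N m : ℕ) (g : ℝ × ((Fin (m + 1)) → Fin N → ℝ) → ℝ) :
    ℝ × ((Fin (m + 2)) → Fin N → ℝ) → ℝ :=
  fun p => xD N m g (p.1, fun k j => p.2 k.castSucc j)
    + ∑ j : Fin N, ∑ k : Fin (m + 1),
        p.2 k.succ j * jetD N m g k j (p.1, fun k' j' => p.2 k'.castSucc j')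

/-- The degree operator on differential functions of order `m`:
`(M h)(x, w) = ∑_j ∑_{k=0}^m w k j ⬝ ∂h/∂(w k j)`. -/
noncomputable def degOp (N m : ℕ) (h : ℝ × ((Fin (m + 1)) → Fin N → ℝ) → ℝ) :
    ℝ × ((Fin (m + 1)) → Fin N → ℝ) → ℝ :=
  fun p => ∑ j : Fin N, ∑ k : Fin (m + 1), p.2 k j * jetD N m h k j p

/-- The partial derivatives along the jet coordinates, weighted by the entries of `w`, add up to
the derivative in the direction `(0, w)`. -/
theorem sum_mul_jetD (N m : ℕ) (g : ℝ × ((Fin (m + 1)) → Fin N → ℝ) → ℝ)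
    (q : ℝ × ((Fin (m + 1)) → Fin N → ℝ)) (w : Fin (m + 1) → Fin N → ℝ) :
    ∑ j : Fin N, ∑ k : Fin (m + 1), w k j * jetD N m g k j q = fderiv ℝ g q (0, w) := by
  have hw : ((0, w) : ℝ × ((Fin (m + 1)) → Fin N → ℝ)) = ∑ j : Fin N, ∑ k : Fin (m + 1),
      w k j • ((0, fun k' j' => if k' = k ∧ j' = j then (1 : ℝ) else 0) :
        ℝ × ((Fin (m + 1)) → Fin N → ℝ)) := by
    refine Prod.ext ?_ ?_
    · simp [Prod.fst_sum]
    · funext k j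
      simp [Prod.snd_sum, Finset.sum_apply, ite_and]
  rw [hw]
  simp only [map_sum, map_smul, smul_eq_mul, jetD]

/-- The degree operator is the derivative along the Euler field of the jet coordinates. -/
theorem degOp_eq_fderiv (N m : ℕ) (h : ℝ × ((Fin (m + 1)) → Fin N → ℝ) → ℝ) :
    degOp N m h = fun p => fderiv ℝ h p (0, p.2) :=
  funext fun p => sum_mul_jetD N m h p p.2

/-- Restriction of a jet of order `m + 1` to order `m`. -/
noncomputable def jetRestrict (N m : ℕ) :
    (ℝ × ((Fin (m + 2)) → Fin N → ℝ)) →L[ℝ] (ℝ × ((Fin (m + 1)) → Fin N → ℝ)) :=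
  LinearMap.toContinuousLinearMap
    { toFun := fun p => (p.1, fun k j => p.2 k.castSucc j)
      map_add' := fun _ _ => rfl
      map_smul' := fun _ _ => rfl }

/-- The shift `w k j ↦ w (k + 1) j`, placed in the jet directions. -/
noncomputable def jetShift (N m : ℕ) :
    (ℝ × ((Fin (m + 2)) → Fin N → ℝ)) →L[ℝ] (ℝ × ((Fin (m + 1)) → Fin N → ℝ)) :=
  LinearMap.toContinuousLinearMap
    { toFun := fun p => (0, fun k j => p.2 k.succ j)
      map_add' := fun _ _ => Prod.ext (add_zero 0).symm rfl
      map_smul' := fun c _ => Prod.ext (mul_zero c).symm rfl }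

/-- The formal total derivative as a directional derivative. -/
theorem totalDx_eq_fderiv (N m : ℕ) (g : ℝ × ((Fin (m + 1)) → Fin N → ℝ) → ℝ) :
    totalDx N m g = fun p => fderiv ℝ g (jetRestrict N m p) ((1, 0) + jetShift N m p) := by
  funext p
  rw [map_add]
  exact congrArg _ (sum_mul_jetD N m g (jetRestrict N m p) fun k j => p.2 k.succ j)

/-- The degree operator and the formal total derivative commute:
`M (D_x g) = D_x (M g)`. -/
theorem degOp_comm_totalDx (N m : ℕ) (hN : 1 ≤ N)
    (g : ℝ × ((Fin (m + 1)) → Fin N → ℝ) → ℝ) (hg : ContDiff ℝ (⊤ : ℕ∞) g) :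
    degOp N (m + 1) (totalDx N m g) = totalDx N m (degOp N m g) := by
  rw [degOp_eq_fderiv, degOp_eq_fderiv, totalDx_eq_fderiv, totalDx_eq_fderiv]
  funext p
  have hg₂ : ContDiff ℝ 2 g := contDiff_infty.1 hg 2
  have hd : ∀ q, HasFDerivAt (fderiv ℝ g) (fderiv ℝ (fderiv ℝ g) q) q := fun q =>
    ((hg₂.fderiv_right (m := 1) one_add_one_eq_two.le).differentiable
      one_ne_zero q).hasFDerivAt
  have hsymm : IsSymmSndFDerivAt ℝ g (jetRestrict N m p) :=
    hg₂.contDiffAt.isSymmSndFDerivAt (by simp)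
  have hl := ((hd (jetRestrict N m p)).comp p (jetRestrict N m).hasFDerivAt).clm_apply
    ((jetShift N m).hasFDerivAt.const_add (1, 0))
  have hr := (hd (jetRestrict N m p)).clm_apply
    ((ContinuousLinearMap.inr ℝ ℝ (Fin (m + 1) → Fin N → ℝ)).comp
      (ContinuousLinearMap.snd ℝ ℝ (Fin (m + 1) → Fin N → ℝ))).hasFDerivAt
  have hl' := congrArg (fun L => L (0, p.2)) hl.fderiv
  have hr' := congrArg (fun L => L ((1, 0) + jetShift N m p)) hr.fderiv
  refine hl'.trans (Eq.trans ?_ hr'.symm)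
  have hV : ((0, ((1, 0) + jetShift N m p).2) : ℝ × ((Fin (m + 1)) → Fin N → ℝ)) =
      jetShift N m (0, p.2) := Prod.ext rfl (zero_add _)
  have hR : ((0, (jetRestrict N m p).2) : ℝ × ((Fin (m + 1)) → Fin N → ℝ)) =
      jetRestrict N m (0, p.2) := rfl
  simp only [add_apply, ContinuousLinearMap.comp_apply,
    ContinuousLinearMap.flip_apply, ContinuousLinearMap.inr_apply,
    ContinuousLinearMap.coe_snd', Function.comp_apply]
  rw [hV, hR, hsymm.eq]
end

section
/- Let N ≥ 1 and M ≥ 1, let f : ℝ × ((Fin (M+1)) → (Fin N) → ℝ) → ℝ be smooth, and let u : ℝ → (Fin N) → ℝ be smooth. For k ∈ Fin (M+1) and j ∈ Fin N set g_{k,j}(x) := (∂f/∂w k j)(x, J^M u x). Then for every x ∈ ℝ the following integration-by-parts identity holds: ∑_{j=1}^{N} u(x)(j) · ∑_{k=0}^{M} (−1)^k · iteratedDeriv k g_{k,j} (x) = ∑_{j=1}^{N} ∑_{i=0}^{M} iteratedDeriv i (fun t => u t j) x · g_{i,j}(x) − deriv (fun x => ∑_{j=1}^{N} ∑_{k=1}^{M}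 ∑_{i=0}^{k−1} (−1)^{k−i−1} · iteratedDeriv i (fun t => u t j) x · iteratedDeriv (k−i−1) g_{k,j} (x)) x. -/
theorem ContDiff.hasDerivAt_iteratedDeriv {v : ℝ → ℝ} (hv : ContDiff ℝ (⊤ : ℕ∞) v) (n : ℕ)
    (x : ℝ) : HasDerivAt (iteratedDeriv n v) (iteratedDeriv (n + 1) v x) x := by
  rw [iteratedDeriv_succ]
  exact (hv.differentiable_iteratedDeriv n (by exact_mod_cast ENat.natCast_lt_top n) x).hasDerivAt

/-- Iterated integration by parts: the derivative of the alternating boundary term telescopes. -/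
theorem hasDerivAt_sum_alternating_iteratedDeriv {v w : ℝ → ℝ} (hv : ContDiff ℝ (⊤ : ℕ∞) v)
    (hw : ContDiff ℝ (⊤ : ℕ∞) w) (k : ℕ) (x : ℝ) :
    HasDerivAt (fun x => ∑ i ∈ Finset.range k,
        (-1 : ℝ) ^ (k - i - 1) * iteratedDeriv i v x * iteratedDeriv (k - i - 1) w x)
      (iteratedDeriv k v x * w x - (-1 : ℝ) ^ k * (v x * iteratedDeriv k w x)) x := by
  have htel := Finset.sum_range_sub
    (fun i => (-1 : ℝ) ^ (k - i) * (iteratedDeriv i v x * iteratedDeriv (k - i) w x)) k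
  simp only [Nat.sub_self, Nat.sub_zero, pow_zero, one_mul, iteratedDeriv_zero] at htel
  rw [← htel]
  refine HasDerivAt.fun_sum fun i hi => ?_
  obtain ⟨m, rfl⟩ := Nat.exists_eq_add_of_lt (Finset.mem_range.mp hi)
  have h₁ : i + m + 1 - i - 1 = m := by omega
  have h₂ : i + m + 1 - (i + 1) = m := by omega
  have h₃ : i + m + 1 - i = m + 1 := by omega
  rw [h₁, h₂, h₃]
  refine (((hv.hasDerivAt_iteratedDeriv i x).const_mul ((-1 : ℝ) ^ m)).mul
    (hw.hasDerivAt_iteratedDeriv m x)).congr_deriv ?_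
  ring

theorem contDiff_jet1 (N M : ℕ) {u : ℝ → Fin N → ℝ} (hu : ContDiff ℝ (⊤ : ℕ∞) u) :
    ContDiff ℝ (⊤ : ℕ∞) (jet1 N M u) := by
  refine contDiff_pi.2 fun k => contDiff_pi.2 fun j => ?_
  simp only [jet1, iteratedDeriv_eq_iterate]
  exact (contDiff_pi.1 hu j).iterate_deriv k

theorem contDiff_jetPartial (N M : ℕ) {f : ℝ × ((Fin (M + 1)) → Fin N → ℝ) → ℝ}
    (hf : ContDiff ℝ (⊤ : ℕ∞) f) (k : Fin (M + 1)) (j : Fin N) :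
    ContDiff ℝ (⊤ : ℕ∞) (jetPartial N M f k j) :=
  (hf.fderiv_right (by simp)).clm_apply contDiff_const

/-- The integration-by-parts identity behind the 1D homotopy operator:
`∑_j u^j ⬝ (Euler operator of f) = (degree operator of f) − D_x (homotopy integrand)`,
all evaluated along a smooth function `u`. -/
theorem euler_eq_degree_sub_deriv_integrand (N M : ℕ) (hN : 1 ≤ N) (hM : 1 ≤ M)
    (f : ℝ × ((Fin (M + 1)) → Fin N → ℝ) → ℝ) (hf : ContDiff ℝ (⊤ : ℕ∞) f)
    (u : ℝ → Fin N → ℝ) (hu : ContDiff ℝ (⊤ : ℕ∞) u)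
    (g : Fin (M + 1) → Fin N → ℝ → ℝ)
    (hg : ∀ k j, g k j = fun x => jetPartial N M f k j (x, jet1 N M u x)) :
    ∀ x : ℝ,
      ∑ j : Fin N, u x j *
          ∑ k : Fin (M + 1), (-1 : ℝ) ^ (k : ℕ) * iteratedDeriv (k : ℕ) (g k j) x
        = ∑ j : Fin N, ∑ i : Fin (M + 1),
            iteratedDeriv (i : ℕ) (fun t => u t j) x * g i j x
          - deriv (fun x => ∑ j : Fin N, ∑ k : Fin (M + 1),
              ∑ i ∈ Finset.range (k : ℕ), (-1 : ℝ) ^ ((k : ℕ) - i - 1) *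
                iteratedDeriv i (fun t => u t j) x *
                iteratedDeriv ((k : ℕ) - i - 1) (g k j) x) x := by
  intro x
  have hv (j : Fin N) : ContDiff ℝ (⊤ : ℕ∞) (fun t => u t j) := contDiff_pi.1 hu j
  have hw (k : Fin (M + 1)) (j : Fin N) : ContDiff ℝ (⊤ : ℕ∞) (g k j) := by
    rw [hg]
    exact (contDiff_jetPartial N M hf k j).comp (contDiff_id.prodMk (contDiff_jet1 N M hu))
  rw [(HasDerivAt.fun_sum fun j _ => HasDerivAt.fun_sum fun k _ =>
    hasDerivAt_sum_alternating_iteratedDeriv (hv j) (hw k j) k x).deriv]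
  simp only [Finset.sum_sub_distrib, sub_sub_cancel, Finset.mul_sum, mul_left_comm]
end

section
/- Let α, β ∈ ℝ with α ≠ 0, and let u : ℝ × ℝ × ℝ → ℝ be a smooth solution of the Zakharov–Kuznetsov equation. Define the density ρ = u³ − (3β/α)(u_x² + u_y²) and the flux components J¹ = (3α/4) u⁴ + 3β u² u_{xx} − 6β u (u_x² + u_y²) + (3β²/α)(u_{xx}² − u_{yy}²) − (6β²/α)(u_x (u_{xxx} + u_{xyy}) + u_y (u_{xxy} + u_{yyy})) and J² = 3β u² u_{xy} + (6β²/α) u_{xy} (u_{xx} + u_{yy}). Then at every point (t,x,y), ∂_t ρ + ∂_x J¹ + ∂_y J² = 0. -/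
/-- Partial derivative with respect to `t` of `u(t,x,y)`. -/
noncomputable def pt (u : ℝ × ℝ × ℝ → ℝ) : ℝ × ℝ × ℝ → ℝ :=
  fun p => deriv (fun s => u (s, p.2.1, p.2.2)) p.1

/-- Partial derivative with respect to `x` of `u(t,x,y)`. -/
noncomputable def px (u : ℝ × ℝ × ℝ → ℝ) : ℝ × ℝ × ℝ → ℝ :=
  fun p => deriv (fun s => u (p.1, s, p.2.2)) p.2.1

/-- Partial derivative with respect to `y` of `u(t,x,y)`. -/
noncomputable def py (u : ℝ × ℝ × ℝ → ℝ) : ℝ × ℝ × ℝ → ℝ :=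
  fun p => deriv (fun s => u (p.1, p.2.1, s)) p.2.2

/-- `u` is a smooth solution of the Zakharov–Kuznetsov equation
`u_t + α u u_x + β (u_{xxx} + u_{xyy}) = 0`. -/
def IsZKSolution (α β : ℝ) (u : ℝ × ℝ × ℝ → ℝ) : Prop :=
  ContDiff ℝ (⊤ : ℕ∞) u ∧
    ∀ p : ℝ × ℝ × ℝ,
      pt u p + α * u p * px u p + β * (px (px (px u)) p + px (py (py u)) p) = 0

open scoped ContDiff

section PartialDerivatives

variable {f : ℝ × ℝ × ℝ → ℝ}

theorem hasDerivAt_pt (hf : ContDiff ℝ ∞ f) (p : ℝ × ℝ × ℝ) :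
    HasDerivAt (fun s => f (s, p.2.1, p.2.2)) (pt f p) p.1 := by
  have hd : Differentiable ℝ f := hf.differentiable (by simp)
  have h : Differentiable ℝ fun s => f (s, p.2.1, p.2.2) := by fun_prop
  exact (h p.1).hasDerivAt

theorem hasDerivAt_px (hf : ContDiff ℝ ∞ f) (p : ℝ × ℝ × ℝ) :
    HasDerivAt (fun s => f (p.1, s, p.2.2)) (px f p) p.2.1 := by
  have hd : Differentiable ℝ f := hf.differentiable (by simp)
  have h : Differentiable ℝ fun s => f (p.1, s, p.2.2) := by fun_prop
  exact (h p.2.1).hasDerivAt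

theorem hasDerivAt_py (hf : ContDiff ℝ ∞ f) (p : ℝ × ℝ × ℝ) :
    HasDerivAt (fun s => f (p.1, p.2.1, s)) (py f p) p.2.2 := by
  have hd : Differentiable ℝ f := hf.differentiable (by simp)
  have h : Differentiable ℝ fun s => f (p.1, p.2.1, s) := by fun_prop
  exact (h p.2.2).hasDerivAt

theorem pt_eq_fderiv (hf : ContDiff ℝ ∞ f) : pt f = fun p => fderiv ℝ f p (1, 0, 0) := by
  funext p
  have hd : DifferentiableAt ℝ f p := hf.differentiable (by simp) p
  exact (hd.hasFDerivAt.comp_hasDerivAt p.1 ((hasDerivAt_id p.1).prodMk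
    ((hasDerivAt_const p.1 p.2.1).prodMk (hasDerivAt_const p.1 p.2.2)))).deriv

theorem px_eq_fderiv (hf : ContDiff ℝ ∞ f) : px f = fun p => fderiv ℝ f p (0, 1, 0) := by
  funext p
  have hd : DifferentiableAt ℝ f p := hf.differentiable (by simp) p
  exact (hd.hasFDerivAt.comp_hasDerivAt p.2.1 ((hasDerivAt_const p.2.1 p.1).prodMk
    ((hasDerivAt_id p.2.1).prodMk (hasDerivAt_const p.2.1 p.2.2)))).deriv

theorem py_eq_fderiv (hf : ContDiff ℝ ∞ f) : py f = fun p => fderiv ℝ f p (0, 0, 1) := by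
  funext p
  have hd : DifferentiableAt ℝ f p := hf.differentiable (by simp) p
  exact (hd.hasFDerivAt.comp_hasDerivAt p.2.2 ((hasDerivAt_const p.2.2 p.1).prodMk
    ((hasDerivAt_const p.2.2 p.2.1).prodMk (hasDerivAt_id p.2.2)))).deriv

theorem contDiff_fderiv_apply_const (hf : ContDiff ℝ ∞ f) (v : ℝ × ℝ × ℝ) :
    ContDiff ℝ ∞ fun p => fderiv ℝ f p v :=
  (hf.fderiv_right (m := ∞) (by simp)).clm_apply contDiff_const

theorem ContDiff.pt (hf : ContDiff ℝ ∞ f) : ContDiff ℝ ∞ (pt f) :=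
  pt_eq_fderiv hf ▸ contDiff_fderiv_apply_const hf _

theorem ContDiff.px (hf : ContDiff ℝ ∞ f) : ContDiff ℝ ∞ (px f) :=
  px_eq_fderiv hf ▸ contDiff_fderiv_apply_const hf _

theorem ContDiff.py (hf : ContDiff ℝ ∞ f) : ContDiff ℝ ∞ (py f) :=
  py_eq_fderiv hf ▸ contDiff_fderiv_apply_const hf _

theorem fderiv_fderiv_apply_comm (hf : ContDiff ℝ ∞ f) (p v w : ℝ × ℝ × ℝ) :
    fderiv ℝ (fun q => fderiv ℝ f q v) p w = fderiv ℝ (fun q => fderiv ℝ f q w) p v := by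
  have hd : DifferentiableAt ℝ (fderiv ℝ f) p :=
    (hf.fderiv_right (m := ∞) (by simp)).differentiable (by simp) p
  have hs : IsSymmSndFDerivAt ℝ f p :=
    hf.contDiffAt.isSymmSndFDerivAt (by
      simpa only [minSmoothness_of_isRCLikeNormedField] using ENat.LEInfty.out)
  rw [fderiv_clm_apply hd (differentiableAt_const v), fderiv_clm_apply hd (differentiableAt_const w)]
  simpa using hs w v

theorem pt_px_comm (hf : ContDiff ℝ ∞ f) : pt (px f) = px (pt f) := by
  rw [pt_eq_fderiv hf.px, px_eq_fderiv hf.pt, px_eq_fderiv hf, pt_eq_fderiv hf]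
  exact funext fun p => fderiv_fderiv_apply_comm hf p _ _

theorem pt_py_comm (hf : ContDiff ℝ ∞ f) : pt (py f) = py (pt f) := by
  rw [pt_eq_fderiv hf.py, py_eq_fderiv hf.pt, py_eq_fderiv hf, pt_eq_fderiv hf]
  exact funext fun p => fderiv_fderiv_apply_comm hf p _ _

theorem py_px_comm (hf : ContDiff ℝ ∞ f) : py (px f) = px (py f) := by
  rw [py_eq_fderiv hf.px, px_eq_fderiv hf.py, px_eq_fderiv hf, py_eq_fderiv hf]
  exact funext fun p => fderiv_fderiv_apply_comm hf p _ _

end PartialDerivatives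

/-- The rank-6 conservation law of the ZK equation: for every smooth solution
`u`, the density `ρ = u³ − (3β/α)(u_x² + u_y²)` and the flux `(J¹, J²)` below
satisfy `D_t ρ + D_x J¹ + D_y J² = 0`. -/
theorem zk_rank6_conservation_law (α β : ℝ) (hα : α ≠ 0) (u : ℝ × ℝ × ℝ → ℝ)
    (hu : IsZKSolution α β u) :
    ∀ p : ℝ × ℝ × ℝ,
      pt (fun q => u q ^ 3 - (3 * β / α) * ((px u q) ^ 2 + (py u q) ^ 2)) p
        + px (fun q => (3 * α / 4) * u q ^ 4 + 3 * β * u q ^ 2 * px (px u) q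
            - 6 * β * u q * ((px u q) ^ 2 + (py u q) ^ 2)
            + (3 * β ^ 2 / α) * ((px (px u) q) ^ 2 - (py (py u) q) ^ 2)
            - (6 * β ^ 2 / α) *
                (px u q * (px (px (px u)) q + px (py (py u)) q)
                  + py u q * (px (px (py u)) q + py (py (py u)) q))) p
        + py (fun q => 3 * β * u q ^ 2 * px (py u) q
            + (6 * β ^ 2 / α) * px (py u) q * (px (px u) q + py (py u) q)) p = 0 := by
  obtain ⟨h, hzk⟩ := hu
  have hut : pt u = fun q =>
      -(α * (u q * px u q) + β * (px (px (px u)) q + px (py (py u)) q)) := by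
    funext q
    linear_combination hzk q
  intro p
  have hutx : px (pt u) p = -(α * (px u p * px u p + u p * px (px u) p)
      + β * (px (px (px (px u))) p + px (px (py (py u))) p)) := by
    rw [hut]
    exact ((((hasDerivAt_px h p).mul (hasDerivAt_px h.px p)).const_mul α).add
      (((hasDerivAt_px h.px.px.px p).add (hasDerivAt_px h.py.py.px p)).const_mul β)).neg.deriv
  have huty : py (pt u) p = -(α * (py u p * px u p + u p * py (px u) p)
      + β * (py (px (px (px u))) p + py (px (py (py u))) p)) := by
    rw [hut]
    exact ((((hasDerivAt_py h p).mul (hasDerivAt_py h.px p)).const_mul α).add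
      (((hasDerivAt_py h.px.px.px p).add (hasDerivAt_py h.py.py.px p)).const_mul β)).neg.deriv
  have hρ := (((hasDerivAt_pt h p).pow 3).sub
    ((((hasDerivAt_pt h.px p).pow 2).add ((hasDerivAt_pt h.py p).pow 2)).const_mul
      (3 * β / α))).deriv
  have hJ₁ := (((((((hasDerivAt_px h p).pow 4).const_mul (3 * α / 4)).add
    ((((hasDerivAt_px h p).pow 2).const_mul (3 * β)).mul (hasDerivAt_px h.px.px p))).sub
    (((hasDerivAt_px h p).const_mul (6 * β)).mul
      (((hasDerivAt_px h.px p).pow 2).add ((hasDerivAt_px h.py p).pow 2)))).add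
    ((((hasDerivAt_px h.px.px p).pow 2).sub ((hasDerivAt_px h.py.py p).pow 2)).const_mul
      (3 * β ^ 2 / α))).sub
    ((((hasDerivAt_px h.px p).mul
        ((hasDerivAt_px h.px.px.px p).add (hasDerivAt_px h.py.py.px p))).add
      ((hasDerivAt_px h.py p).mul
        ((hasDerivAt_px h.py.px.px p).add (hasDerivAt_px h.py.py.py p)))).const_mul
      (6 * β ^ 2 / α))).deriv
  have hJ₂ := (((((hasDerivAt_py h p).pow 2).const_mul (3 * β)).mul (hasDerivAt_py h.py.px p)).add
    (((hasDerivAt_py h.py.px p).const_mul (6 * β ^ 2 / α)).mul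
      ((hasDerivAt_py h.px.px p).add (hasDerivAt_py h.py.py p)))).deriv
  refine (congrArg₂ (· + ·) (congrArg₂ (· + ·) hρ hJ₁) hJ₂).trans ?_
  simp only [pt_px_comm h, pt_py_comm h, hutx, huty, congrFun hut p, py_px_comm h, py_px_comm h.px,
    py_px_comm h.px.px, py_px_comm h.py, py_px_comm h.py.py, Pi.add_apply,
    Pi.pow_apply, Prod.mk.eta]
  field_simp
  ring
end
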